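/- arXiv:0709.1435 — 2 statements merged into one kernel-verified Lean document; each statement's English description precedes it below -/
import Mathlib

section
/- Let 0 < α < 1 and let g : (1/2,1) → (-1,1) be continuously differentiable with g(r) → 1 as r → 1⁻. If the function h(r) = r·g'(r)·((1-r)/(1-g(r)))^α is bounded on (1/2,1), then the function u(r) = (1-g(r))/(1-r) is bounded on (1/2,1). -/
open Set Filter Topology

/-- If `g : (1/2,1) → (-1,1)` is continuously differentiable with `g(r) → 1` as `r → 1⁻`,
and `h(r) = r g'(r) ((1-r)/(1-g(r)))^α` is bounded on `(1/2,1)` (where `0 < α < 1`),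
then `u(r) = (1-g(r))/(1-r)` is bounded on `(1/2,1)`. -/
theorem bounded_ratio_of_bounded_weighted_deriv
    (α : ℝ) (hα0 : 0 < α) (hα1 : α < 1) (g g' : ℝ → ℝ)
    (hderiv : ∀ r ∈ Ioo (1/2 : ℝ) 1, HasDerivAt g (g' r) r)
    (hcont : ContinuousOn g' (Ioo (1/2 : ℝ) 1))
    (hrange : ∀ r ∈ Ioo (1/2 : ℝ) 1, g r ∈ Ioo (-1 : ℝ) 1)
    (hlim : Tendsto g (𝓝[<] (1 : ℝ)) (𝓝 1))
    (hbdd : ∃ M : ℝ, ∀ r ∈ Ioo (1/2 : ℝ) 1,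
      |r * g' r * ((1 - r) / (1 - g r)) ^ α| ≤ M) :
    ∃ M : ℝ, ∀ r ∈ Ioo (1/2 : ℝ) 1, (1 - g r) / (1 - r) ≤ M := by
  obtain ⟨M, hM⟩ := hbdd
  have hβ : 0 < 1 - α := by linarith
  have hM0 : 0 ≤ M := (abs_nonneg _).trans (hM (3 / 4) (by norm_num))
  set F : ℝ → ℝ := fun r => (1 - g r) ^ (1 - α) - 2 * M * (1 - r) ^ (1 - α) with hF
  have hFderiv : ∀ r ∈ Ioo (1/2 : ℝ) 1, HasDerivAt F
      (-g' r * (1 - α) * (1 - g r) ^ (1 - α - 1)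
        - 2 * M * (-1 * (1 - α) * (1 - r) ^ (1 - α - 1))) r := by
    intro r hr
    have hf : 0 < 1 - g r := sub_pos.2 (hrange r hr).2
    have hs : 0 < 1 - r := sub_pos.2 hr.2
    exact (((hderiv r hr).const_sub 1).rpow_const (Or.inl hf.ne')).sub
      ((((hasDerivAt_id r).const_sub 1).rpow_const (Or.inl hs.ne')).const_mul (2 * M))
  have hFmono : MonotoneOn F (Ioo (1/2 : ℝ) 1) := by
    refine monotoneOn_of_deriv_nonneg (convex_Ioo _ _)
      (fun r hr => (hFderiv r hr).continuousAt.continuousWithinAt)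
      (fun r hr => (hFderiv r (interior_subset hr)).differentiableAt.differentiableWithinAt) ?_
    intro r hr
    replace hr := interior_subset hr
    rw [(hFderiv r hr).deriv]
    have hf : 0 < 1 - g r := sub_pos.2 (hrange r hr).2
    have hs : 0 < 1 - r := sub_pos.2 hr.2
    have hsα : 0 < (1 - r) ^ α := Real.rpow_pos_of_pos hs α
    have hfα : 0 < (1 - g r) ^ α := Real.rpow_pos_of_pos hf α
    have hle := (le_abs_self _).trans (hM r hr)
    have hweighted : g' r * ((1 - r) / (1 - g r)) ^ α ≤ 2 * M := by
      rw [mul_assoc] at hle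
      nlinarith [hr.1]
    rw [Real.div_rpow hs.le hf.le, ← mul_div_assoc, div_le_iff₀ hfα] at hweighted
    rw [show 1 - α - 1 = -α by ring, Real.rpow_neg hf.le, Real.rpow_neg hs.le]
    have hquot : g' r * ((1 - g r) ^ α)⁻¹ ≤ 2 * M * ((1 - r) ^ α)⁻¹ := by
      rw [← div_eq_mul_inv, ← div_eq_mul_inv, div_le_div_iff₀ hfα hsα]
      exact hweighted
    nlinarith
  have hFlim : Tendsto F (𝓝[<] (1 : ℝ)) (𝓝 0) := by
    have h1 : Tendsto (fun r => (1 - g r) ^ (1 - α)) (𝓝[<] (1 : ℝ)) (𝓝 0) := by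
      simpa [Real.zero_rpow hβ.ne'] using
        (hlim.const_sub 1).rpow_const (p := 1 - α) (Or.inr hβ.le)
    have h2 : Tendsto (fun r : ℝ => (1 - r) ^ (1 - α)) (𝓝[<] (1 : ℝ)) (𝓝 0) := by
      have hid : Tendsto (fun r : ℝ => r) (𝓝[<] (1 : ℝ)) (𝓝 1) :=
        tendsto_id.mono_left nhdsWithin_le_nhds
      simpa [Real.zero_rpow hβ.ne'] using
        (hid.const_sub 1).rpow_const (p := 1 - α) (Or.inr hβ.le)
    simpa using h1.sub (h2.const_mul (2 * M))
  refine ⟨(2 * M) ^ (1 - α)⁻¹, fun r hr => ?_⟩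
  have hf : 0 < 1 - g r := sub_pos.2 (hrange r hr).2
  have hs : 0 < 1 - r := sub_pos.2 hr.2
  have hFr : F r ≤ 0 := by
    refine ge_of_tendsto hFlim ?_
    filter_upwards [Ioo_mem_nhdsLT hr.2] with x hx
    exact hFmono hr ⟨hr.1.trans hx.1, hx.2⟩ hx.1.le
  rw [Real.le_rpow_inv_iff_of_pos (div_pos hf hs).le (by positivity) hβ,
    Real.div_rpow hf.le hs.le, div_le_iff₀ (Real.rpow_pos_of_pos hs _)]
  exact sub_nonpos.1 hFr
end

section
/- Let 0 < α < 1 and let h : (1/2,1) → ℝ be continuous and bounded. Suppose v : (1/2,1) → ℝ is differentiable, satisfies -(1/(1-α))·(1-r)·v'(r) + v(r) = h(r)/r for all r ∈ (1/2,1), and (1-r)^{1-α}·v(r) → 0 as r → 1⁻. Then v is bounded on (1/2,1). -/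
open Set Filter Topology

/-- One-sided comparison principle for `-(1/β)(1-r)v'(r) + v(r) = g(r)` on `(a,1)`: an upper bound
for `g` is an upper bound for every solution `v` with `(1-r)^β v(r) → 0` as `r → 1⁻`. -/
theorem le_of_ode_of_tendsto_zero {a β C : ℝ} (hβ : 0 < β) {g v v' : ℝ → ℝ}
    (hg : ∀ r ∈ Ioo a 1, g r ≤ C)
    (hderiv : ∀ r ∈ Ioo a 1, HasDerivAt v (v' r) r)
    (hode : ∀ r ∈ Ioo a 1, -(1 / β) * (1 - r) * v' r + v r = g r)
    (hzero : Tendsto (fun r => (1 - r) ^ β * v r) (𝓝[<] (1 : ℝ)) (𝓝 0)) :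
    ∀ r ∈ Ioo a 1, v r ≤ C := by
  set u : ℝ → ℝ := fun r => (1 - r) ^ β * (v r - C) with hu
  have hu_deriv : ∀ r ∈ Ioo a 1, HasDerivAt u (β * (1 - r) ^ (β - 1) * (C - g r)) r := by
    intro r hr
    have hr1 : 0 < 1 - r := sub_pos.2 hr.2
    have hpow := ((hasDerivAt_id r).const_sub 1).rpow_const (p := β) (Or.inl hr1.ne')
    refine (hpow.mul ((hderiv r hr).sub_const C)).congr_deriv ?_
    have hsplit : (1 - r) ^ β = (1 - r) ^ (β - 1) * (1 - r) := by
      rw [← Real.rpow_add_one hr1.ne', sub_add_cancel]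
    rw [← hode r hr]
    simp only [id, hsplit]
    field_simp
    ring
  have hmono : MonotoneOn u (Ioo a 1) := by
    refine monotoneOn_of_deriv_nonneg (convex_Ioo a 1)
      (fun r hr => (hu_deriv r hr).continuousAt.continuousWithinAt) ?_ ?_
    · rw [interior_Ioo]
      exact fun r hr => (hu_deriv r hr).differentiableAt.differentiableWithinAt
    · rw [interior_Ioo]
      intro r hr
      rw [(hu_deriv r hr).deriv]
      have hr1 : 0 < 1 - r := sub_pos.2 hr.2
      have := sub_nonneg.2 (hg r hr)
      positivity
  have hpow_zero : Tendsto (fun r : ℝ => (1 - r) ^ β) (𝓝[<] (1 : ℝ)) (𝓝 0) := by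
    have hcont : ContinuousAt (fun r : ℝ => (1 - r) ^ β) 1 :=
      (continuousAt_const.sub continuousAt_id).rpow_const (Or.inr hβ.le)
    simpa [Real.zero_rpow hβ.ne'] using hcont.tendsto.mono_left nhdsWithin_le_nhds
  have hu_zero : Tendsto u (𝓝[<] (1 : ℝ)) (𝓝 0) := by
    simpa [hu, mul_sub] using hzero.sub (hpow_zero.mul_const C)
  intro r hr
  have hur : u r ≤ 0 := by
    refine ge_of_tendsto hu_zero ?_
    filter_upwards [Ioo_mem_nhdsLT hr.2] with s hs
    exact hmono hr ⟨hr.1.trans hs.1, hs.2⟩ hs.1.le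
  have hpos : 0 < (1 - r) ^ β := Real.rpow_pos_of_pos (sub_pos.2 hr.2) β
  exact sub_nonpos.1 (nonpos_of_mul_nonpos_right hur hpos)

/-- If `h` is continuous and bounded on `(1/2,1)`, `v` solves
`-(1/(1-α))(1-r)v'(r) + v(r) = h(r)/r` on `(1/2,1)`, and `(1-r)^{1-α} v(r) → 0` as
`r → 1⁻`, then `v` is bounded on `(1/2,1)`. -/
theorem ode_solution_bounded
    (α : ℝ) (hα0 : 0 < α) (hα1 : α < 1) (h v v' : ℝ → ℝ)
    (hh : ContinuousOn h (Ioo (1/2 : ℝ) 1))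
    (hhb : ∃ M : ℝ, ∀ r ∈ Ioo (1/2 : ℝ) 1, |h r| ≤ M)
    (hderiv : ∀ r ∈ Ioo (1/2 : ℝ) 1, HasDerivAt v (v' r) r)
    (hode : ∀ r ∈ Ioo (1/2 : ℝ) 1,
      -(1 / (1 - α)) * (1 - r) * v' r + v r = h r / r)
    (hzero : Tendsto (fun r => (1 - r) ^ (1 - α) * v r) (𝓝[<] (1 : ℝ)) (𝓝 0)) :
    ∃ M : ℝ, ∀ r ∈ Ioo (1/2 : ℝ) 1, |v r| ≤ M := by
  obtain ⟨M, hM⟩ := hhb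
  have hβ : 0 < 1 - α := sub_pos.2 hα1
  have hbound : ∀ r ∈ Ioo (1/2 : ℝ) 1, |h r / r| ≤ 2 * M := by
    intro r hr
    have hr0 : 0 < r := by linarith [hr.1]
    rw [abs_div, abs_of_pos hr0, div_le_iff₀ hr0]
    nlinarith [hM r hr, abs_nonneg (h r), hr.1]
  refine ⟨2 * M, fun r hr => abs_le'.2 ⟨?_, ?_⟩⟩
  · exact le_of_ode_of_tendsto_zero hβ (fun s hs => (abs_le'.1 (hbound s hs)).1)
      hderiv hode hzero r hr
  · refine le_of_ode_of_tendsto_zero (v := fun s => -v s) (v' := fun s => -v' s) hβ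
      (fun s hs => (abs_le'.1 (hbound s hs)).2) (fun s hs => (hderiv s hs).neg)
      (fun s hs => ?_) ?_ r hr
    · rw [← hode s hs]
      ring
    · simpa using hzero.neg
end
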